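/- arXiv:math/0404079 — 2 statements merged into one kernel-verified Lean document; each statement's English description precedes it below -/
import Mathlib

section
/- Let n ≥ 4 and, for each d ≥ 0, let (F_2)_d, F_d, (F_1)_d denote the degree-d homogeneous components of F_2, F, F_1 respectively (so (F_1)_d ⊆ F_d ⊆ (F_2)_d). Then, as formal power series in q over ℚ: Σ_{d=0}^∞ (dim_ℂ (F_2)_d − dim_ℂ F_d) q^d = q^{(n-1)(n-3)}/((q)_1 (q)_{n-3}) and Σ_{d=0}^∞ (dim_ℂ F_d − dim_ℂ (F_1)_d) q^d = q^{(n-2)(n-1)}/((q)_1 (q)_{n-2}), where (q)_s = ∏_{j=1}^s (1 − q^j) and division by (q)_s means multiplication by its inverse in the formal power series ring. -/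
open MvPolynomial Finset

/-- Substitution `x₂ := x₁, x₄ := x₃`. -/
noncomputable def sub24 (n : ℕ) (hn : 4 ≤ n) :
    MvPolynomial (Fin n) ℂ →ₐ[ℂ] MvPolynomial (Fin n) ℂ :=
  MvPolynomial.aeval
    (fun i : Fin n => if (i : ℕ) = 1 then X (⟨0, by omega⟩ : Fin n)
      else if (i : ℕ) = 3 then X (⟨2, by omega⟩ : Fin n)
      else (X i : MvPolynomial (Fin n) ℂ))

/-- Substitution `x₂ := x₁, x₃ := x₁`. -/
noncomputable def sub123 (n : ℕ) (hn : 4 ≤ n) :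
    MvPolynomial (Fin n) ℂ →ₐ[ℂ] MvPolynomial (Fin n) ℂ :=
  MvPolynomial.aeval
    (fun i : Fin n => if (i : ℕ) ≤ 2 then X (⟨0, by omega⟩ : Fin n)
      else (X i : MvPolynomial (Fin n) ℂ))

/-- Substitution `x₂ := x₁`. -/
noncomputable def sub12 (n : ℕ) (hn : 4 ≤ n) :
    MvPolynomial (Fin n) ℂ →ₐ[ℂ] MvPolynomial (Fin n) ℂ :=
  MvPolynomial.aeval
    (fun i : Fin n => if (i : ℕ) = 1 then X (⟨0, by omega⟩ : Fin n)
      else (X i : MvPolynomial (Fin n) ℂ))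

/-- Degree-`d` component of `F₂ = {f symmetric : f(x,x,y,y,x₅,…) = 0}`. -/
noncomputable def F2Component (n : ℕ) (hn : 4 ≤ n) (d : ℕ) :
    Submodule ℂ (MvPolynomial (Fin n) ℂ) :=
  (Subalgebra.toSubmodule (MvPolynomial.symmetricSubalgebra (Fin n) ℂ) :
      Submodule ℂ (MvPolynomial (Fin n) ℂ)) ⊓
  LinearMap.ker (sub24 n hn).toLinearMap ⊓
  MvPolynomial.homogeneousSubmodule (Fin n) ℂ d

/-- Degree-`d` component of `F = {f symmetric : f(x,x,y,y,x₅,…) = 0 ∧ f(x,x,x,x₄,…) = 0}`. -/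
noncomputable def FComponent (n : ℕ) (hn : 4 ≤ n) (d : ℕ) :
    Submodule ℂ (MvPolynomial (Fin n) ℂ) :=
  F2Component n hn d ⊓ LinearMap.ker (sub123 n hn).toLinearMap

/-- Degree-`d` component of `F₁ = {f symmetric : f(x,x,x₃,…) = 0}`. -/
noncomputable def F1Component (n : ℕ) (hn : 4 ≤ n) (d : ℕ) :
    Submodule ℂ (MvPolynomial (Fin n) ℂ) :=
  (Subalgebra.toSubmodule (MvPolynomial.symmetricSubalgebra (Fin n) ℂ) :
      Submodule ℂ (MvPolynomial (Fin n) ℂ)) ⊓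
  LinearMap.ker (sub12 n hn).toLinearMap ⊓
  MvPolynomial.homogeneousSubmodule (Fin n) ℂ d

/-- `(q)_s = ∏_{j=1}^s (1 - q^j)` as a formal power series over `ℚ`. -/
noncomputable def qPoch (s : ℕ) : PowerSeries ℚ :=
  ∏ j ∈ Finset.range s, (1 - (PowerSeries.X : PowerSeries ℚ) ^ (j + 1))

namespace MvPolynomial

variable {σ τ υ R : Type*} [CommRing R]

theorem X_sub_X_dvd_sub_rename_update [DecidableEq σ] (i j : σ) (p : MvPolynomial σ R) :
    X i - X j ∣ p - rename (Function.update id i j) p := by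
  induction p using MvPolynomial.induction_on with
  | C a => simp
  | add p q hp hq =>
    rw [map_add, add_sub_add_comm]
    exact dvd_add hp hq
  | mul_X p k hp =>
    rw [map_mul, rename_X]
    refine (Ideal.mem_span_singleton (α := MvPolynomial σ R)).1 ?_
    rw [← Ideal.Quotient.eq]
    rw [← Ideal.mem_span_singleton, ← Ideal.Quotient.eq] at hp
    rw [map_mul, map_mul, hp]
    congr 1
    rw [Ideal.Quotient.eq, Ideal.mem_span_singleton]
    by_cases h : k = i
    · subst h; simp
    · simp [h]

/-- A polynomial is divisible by `X i - X j` iff it vanishes under some substitution that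
identifies exactly `i` and `j`. -/
theorem X_sub_X_dvd_iff [DecidableEq σ] (i j : σ) (p : MvPolynomial σ R) :
    X i - X j ∣ p ↔ rename (Function.update id i j) p = 0 := by
  constructor
  · rintro ⟨q, rfl⟩
    by_cases h : j = i
    · subst h; simp
    · simp [h]
  · intro h
    simpa [h] using X_sub_X_dvd_sub_rename_update i j p

theorem prime_X_sub_X [IsDomain R] {i j : σ} (h : i ≠ j) :
    Prime (X i - X j : MvPolynomial σ R) := by
  classical
  refine ⟨sub_ne_zero.2 fun h' => h (X_injective h'), fun hu => ?_, fun a b hab => ?_⟩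
  · have := (X_sub_X_dvd_iff i j (1 : MvPolynomial σ R)).1 (isUnit_iff_dvd_one.1 hu)
    simp at this
  · simpa only [X_sub_X_dvd_iff, map_mul, mul_eq_zero] using hab

theorem sq_X_sub_X_dvd_of_swap [IsDomain R] [CharZero R] [DecidableEq σ] {i j : σ} (h : i ≠ j)
    {p : MvPolynomial σ R} (hswap : rename (Equiv.swap i j) p = p) (hp : X i - X j ∣ p) :
    (X i - X j) ^ 2 ∣ p := by
  obtain ⟨q, rfl⟩ := hp
  have hd : (X i - X j : MvPolynomial σ R) ≠ 0 := (prime_X_sub_X h).ne_zero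
  have hq : rename (Equiv.swap i j) q = -q := by
    apply mul_left_cancel₀ hd
    rw [← sub_eq_zero] at hswap ⊢
    rw [← neg_eq_zero, ← hswap]
    simp
    ring
  rw [sq]
  refine mul_dvd_mul_left _ ((X_sub_X_dvd_iff i j q).2 ?_)
  have h2 := congrArg (rename (Function.update id i j)) hq
  rw [rename_rename, map_neg] at h2
  have h3 : Function.update id i j ∘ Equiv.swap i j = Function.update id i j := by
    funext k
    by_cases hi : k = i
    · subst hi; simp [h.symm]
    · by_cases hj : k = j
      · subst hj; simp [h.symm]
      · simp [Equiv.swap_apply_of_ne_of_ne hi hj]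
  rw [h3] at h2
  exact self_eq_neg.1 h2

theorem pderiv_rename_eq_sum [Fintype σ] [DecidableEq τ] (g : σ → τ) (t : τ)
    (f : MvPolynomial σ R) :
    pderiv t (rename g f) = ∑ i with g i = t, rename g (pderiv i f) := by
  classical
  induction f using MvPolynomial.induction_on with
  | C a => simp
  | add p q hp hq => simp only [map_add, hp, hq, sum_add_distrib]
  | mul_X p k hp =>
    have h : ∑ i with g i = t, rename g (pderiv i (X k : MvPolynomial σ R)) =
        pderiv t (X (g k)) := by
      by_cases hk : g k = t <;> simp [pderiv_X, Pi.single_apply, apply_ite, hk]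
    simp only [map_mul, rename_X, Derivation.leibniz, smul_eq_mul, map_add, hp, sum_add_distrib,
      ← mul_sum, h]

theorem IsSymmetric.rename_comp {f : MvPolynomial σ R} (hf : f.IsSymmetric) (g : σ → τ)
    (e : Equiv.Perm σ) : rename (g ∘ e) f = rename g f := by
  rw [← rename_rename, hf e]

theorem IsSymmetric.rename_pderiv_eq {f : MvPolynomial σ R} (hf : f.IsSymmetric) {g : σ → τ}
    {a b : σ} (h : g a = g b) : rename g (pderiv a f) = rename g (pderiv b f) := by
  classical
  have h1 := pderiv_rename (Equiv.swap a b).injective a f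
  rw [hf, Equiv.swap_apply_left] at h1
  rw [h1, rename_rename]
  congr 2
  funext k
  simp only [Function.comp_apply, Equiv.swap_apply_def]
  split_ifs <;> simp_all

theorem IsSymmetric.card_mul_rename_pderiv [Fintype σ] [DecidableEq τ] {f : MvPolynomial σ R}
    (hf : f.IsSymmetric) (g : σ → τ) (e : τ → υ) {s t : τ} (h : e s = e t) :
    (#{i | g i = t} : MvPolynomial υ R) * rename e (pderiv s (rename g f)) =
      (#{i | g i = s} : MvPolynomial υ R) * rename e (pderiv t (rename g f)) := by
  rw [pderiv_rename_eq_sum, pderiv_rename_eq_sum, map_sum, map_sum]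
  simp only [rename_rename]
  rw [← nsmul_eq_mul, ← nsmul_eq_mul, ← sum_const, ← sum_const, sum_comm]
  refine sum_congr rfl fun i hi => sum_congr rfl fun j hj => hf.rename_pderiv_eq ?_
  simp_all

end MvPolynomial

namespace MvPolynomial

variable {K : Type*} [Field K]

theorem isRelPrime_X_sub_X {σ : Type*} [DecidableEq σ] {a b c d : σ} (hab : a ≠ b)
    (h : Function.update id a b c ≠ Function.update id a b d) :
    IsRelPrime (X a - X b : MvPolynomial σ K) (X c - X d) := by
  rw [(prime_X_sub_X hab).irreducible.isRelPrime_iff_not_dvd, X_sub_X_dvd_iff, map_sub,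
    rename_X, rename_X, sub_eq_zero]
  exact fun hc => h (X_injective hc)

/-- The product of all `X (a i) - X (b k)` and of all `(X (b l) - X (b k))^2` with `k < l`. -/
noncomputable def blockDiscr (K : Type*) [Field K] {σ : Type*} {m r : ℕ} (a : Fin m → σ)
    (b : Fin r → σ) : MvPolynomial σ K :=
  (∏ k, ∏ i, (X (a i) - X (b k))) * (∏ k, ∏ l ∈ Ioi k, (X (b l) - X (b k))) ^ 2

section blockDiscr

variable {σ τ : Type*} {m r : ℕ} {a : Fin m → σ} {b : Fin r → σ}

theorem rename_blockDiscr (g : σ → τ) (a : Fin m → σ) (b : Fin r → σ) :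
    rename g (blockDiscr K a b) = blockDiscr K (g ∘ a) (g ∘ b) := by
  simp [blockDiscr]

theorem blockDiscr_eq_zero {i : Fin m} {k : Fin r} (h : a i = b k) : blockDiscr K a b = 0 :=
  mul_eq_zero_of_left (prod_eq_zero (mem_univ k) (prod_eq_zero (mem_univ i) (by rw [h, sub_self]))) _

theorem blockDiscr_eq_zero_of_not_injective (h : ¬ Function.Injective b) :
    blockDiscr K a b = 0 := by
  refine mul_eq_zero_of_right _ (pow_eq_zero_iff two_ne_zero |>.2 ?_)
  rw [← Matrix.det_vandermonde fun k => (X (b k) : MvPolynomial σ K)]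
  by_contra h0
  exact h fun k l hkl => Matrix.det_vandermonde_ne_zero_iff.1 h0 (by rw [hkl])

theorem blockDiscr_comp_perm (e : Equiv.Perm (Fin r)) :
    blockDiscr K a (b ∘ e) = blockDiscr K a b := by
  unfold blockDiscr
  congr 1
  · exact Equiv.prod_comp e fun k => ∏ i, (X (a i) - X (b k) : MvPolynomial σ K)
  · have h (v : Fin r → MvPolynomial σ K) :
        (Matrix.vandermonde (v ∘ e)).det = _ := Matrix.det_permute e (Matrix.vandermonde v)
    have h1 := h fun k => X (b k)
    rw [Matrix.det_vandermonde, Matrix.det_vandermonde] at h1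
    simp only [Function.comp_apply] at h1 ⊢
    rw [h1, mul_pow, ← Int.cast_pow, ← Units.val_pow_eq_pow_val, Int.units_sq]
    simp

theorem isHomogeneous_blockDiscr (a : Fin m → σ) (b : Fin r → σ) :
    (blockDiscr K a b).IsHomogeneous (r * m + r * (r - 1)) := by
  have h (a b : σ) : (X a - X b : MvPolynomial σ K).IsHomogeneous 1 :=
    (isHomogeneous_X _ _).sub (isHomogeneous_X _ _)
  have hsum : (∑ k : Fin r, ∑ _l ∈ Ioi k, 1) * 2 = r * (r - 1) := by
    rw [← Finset.sum_range_id_mul_two, ← Fin.sum_univ_eq_sum_range, ← Equiv.sum_comp Fin.revPerm]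
    congr 1
    refine sum_congr rfl fun k _ => ?_
    simp [Fin.card_Ioi, Fin.val_rev]
    omega
  have hsum' : ∑ _k : Fin r, ∑ _i : Fin m, 1 = r * m := by simp
  rw [← hsum, ← hsum']
  exact (IsHomogeneous.prod _ _ _ fun k _ => IsHomogeneous.prod _ _ _ fun i _ => h _ _).mul
    ((IsHomogeneous.prod _ _ _ fun k _ => IsHomogeneous.prod _ _ _ fun l _ => h _ _).pow 2)

end blockDiscr

/-- The polynomial `∏ (x - z_k)^m * ∏_{k < l} (z_l - z_k)^2`, where `x = X none` and
`z_k = X (some k)`. -/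
noncomputable def collapseDiscr (K : Type*) [Field K] (m r : ℕ) : MvPolynomial (Option (Fin r)) K :=
  blockDiscr K (fun _ : Fin m => none) some

theorem collapseDiscr_ne_zero (m r : ℕ) : collapseDiscr K m r ≠ 0 := by
  refine mul_ne_zero (prod_ne_zero_iff.2 fun k _ => prod_ne_zero_iff.2 fun i _ => ?_)
    (pow_ne_zero _ (prod_ne_zero_iff.2 fun k _ => prod_ne_zero_iff.2 fun l hl => ?_))
  · exact (prime_X_sub_X (by simp)).ne_zero
  · exact (prime_X_sub_X (by simpa using (mem_Ioi.1 hl).ne')).ne_zero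

theorem rename_collapseDiscr (m r : ℕ) (e : Equiv.Perm (Fin r)) :
    rename (Option.map e) (collapseDiscr K m r) = collapseDiscr K m r := by
  rw [collapseDiscr, rename_blockDiscr]
  exact blockDiscr_comp_perm e

theorem collapseDiscr_dvd {m r : ℕ} {p : MvPolynomial (Option (Fin r)) K}
    (h1 : ∀ k, (X none - X (some k)) ^ m ∣ p)
    (h2 : ∀ k l, k ≠ l → (X (some k) - X (some l)) ^ 2 ∣ p) : collapseDiscr K m r ∣ p := by
  simp only [collapseDiscr, blockDiscr, prod_const, card_univ, Fintype.card_fin, ← prod_pow]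
  refine IsRelPrime.mul_dvd ?_ (prod_dvd_of_isRelPrime ?_ fun k _ => h1 k)
    (prod_dvd_of_isRelPrime ?_ fun k _ => prod_dvd_of_isRelPrime ?_ fun l hl =>
      h2 l k (mem_Ioi.1 hl).ne')
  · refine .prod_left fun k _ => .prod_right fun k' _ => .prod_right fun l hl => .pow ?_
    have := (mem_Ioi.1 hl).ne'
    apply isRelPrime_X_sub_X <;> grind
  · refine fun k _ l _ hkl => .pow ?_
    apply isRelPrime_X_sub_X <;> grind
  · refine fun k _ k' _ hkl => .prod_left fun l hl => .prod_right fun l' hl' => .pow ?_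
    have := (mem_Ioi.1 hl)
    have := (mem_Ioi.1 hl')
    apply isRelPrime_X_sub_X <;> grind
  · refine fun l hl l' hl' hkl => .pow ?_
    have := (mem_Ioi.1 hl)
    have := (mem_Ioi.1 hl')
    apply isRelPrime_X_sub_X <;> grind

/-- The map sending the first `m` indices to `none` and keeping the other ones apart. -/
def collapse (m n : ℕ) (i : Fin n) : Option (Fin (n - m)) :=
  if h : (i : ℕ) < m then none else some ⟨i - m, by omega⟩

theorem collapse_eq_none {m n : ℕ} {i : Fin n} : collapse m n i = none ↔ (i : ℕ) < m := by
  simp [collapse]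

theorem collapse_eq_some {m n : ℕ} {i : Fin n} {k : Fin (n - m)} :
    collapse m n i = some k ↔ (i : ℕ) = m + k := by
  by_cases h : (i : ℕ) < m
  · simp [collapse, h]; omega
  · simp [collapse, h, Fin.ext_iff]; omega

theorem card_collapse_eq_none {m n : ℕ} (h : m ≤ n) : #{i | collapse m n i = none} = m := by
  simp only [collapse_eq_none]
  rw [Fin.card_filter_val_lt]
  simpa using h

theorem card_collapse_eq_some {m n : ℕ} (k : Fin (n - m)) :
    #{i | collapse m n i = some k} = 1 := by
  simp only [collapse_eq_some]
  rw [card_eq_one]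
  refine ⟨⟨m + k, by omega⟩, ?_⟩
  ext i
  simp [Fin.ext_iff]

theorem exists_collapse_comp_perm {m n : ℕ} (e : Equiv.Perm (Fin (n - m))) :
    ∃ e' : Equiv.Perm (Fin n), collapse m n ∘ e' = Option.map e ∘ collapse m n := by
  let ι : Fin (n - m) ↪ Fin n :=
    ⟨fun k => ⟨m + k, by omega⟩, fun a b h => by simpa [Fin.ext_iff] using h⟩
  have hι (k) : (ι k : ℕ) = m + k := rfl
  refine ⟨e.viaFintypeEmbedding ι, ?_⟩
  funext i
  by_cases h : (i : ℕ) < m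
  · have h' : i ∉ Set.range ι := by
      rintro ⟨k, rfl⟩
      rw [hι] at h
      omega
    simp [Equiv.Perm.viaFintypeEmbedding_apply_notMem_range _ _ h', collapse_eq_none.2 h]
  · obtain ⟨k, rfl⟩ : ∃ k, ι k = i :=
      ⟨⟨i - m, by omega⟩, Fin.ext (by rw [hι]; exact Nat.add_sub_of_le (not_lt.1 h))⟩
    have h' (k) : collapse m n (ι k) = some k := collapse_eq_some.2 rfl
    simp [h', Equiv.Perm.viaFintypeEmbedding_apply_image]

/-- A polynomial that restricts to `collapseDiscr K m (n - m) * q` under `collapse m n`; its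
symmetrization does so up to a nonzero scalar. -/
noncomputable def collapseLift {m n : ℕ} (hm : m < n) (q : MvPolynomial (Option (Fin (n - m))) K) :
    MvPolynomial (Fin n) K :=
  blockDiscr K (fun i : Fin m => ⟨i, by omega⟩) (fun k : Fin (n - m) => ⟨m + k, by omega⟩) *
    rename (fun a : Option (Fin (n - m)) => a.elim ⟨0, by omega⟩ fun k => ⟨m + k, by omega⟩) q

theorem rename_collapseLift_eq_zero {τ : Type*} {m n : ℕ} (hm : m < n)
    (q : MvPolynomial (Option (Fin (n - m))) K) {g : Fin n → τ} {i j : Fin n} (hij : i ≠ j)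
    (hj : m ≤ j) (hg : g i = g j) : rename g (collapseLift hm q) = 0 := by
  rw [collapseLift, map_mul, rename_blockDiscr]
  refine mul_eq_zero_of_left ?_ _
  have hj' : (⟨m + (j - m), by omega⟩ : Fin n) = j := Fin.ext (by simp; omega)
  by_cases hi : (i : ℕ) < m
  · exact blockDiscr_eq_zero (i := ⟨i, hi⟩) (k := ⟨j - m, by omega⟩) (by simpa [hj'] using hg)
  · have hi' : (⟨m + (i - m), by omega⟩ : Fin n) = i := Fin.ext (by simp; omega)
    refine blockDiscr_eq_zero_of_not_injective fun hinj => hij ?_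
    have := @hinj ⟨i - m, by omega⟩ ⟨j - m, by omega⟩ (by simpa [hi', hj'] using hg)
    simp [Fin.ext_iff] at this
    omega

theorem rename_collapse_collapseLift {m n : ℕ} (h0 : 0 < m) (hm : m < n)
    (q : MvPolynomial (Option (Fin (n - m))) K) :
    rename (collapse m n) (collapseLift hm q) = collapseDiscr K m (n - m) * q := by
  have h1 : (collapse m n ∘ fun i : Fin m => ⟨i, by omega⟩) = fun _ => none := by
    funext i
    exact collapse_eq_none.2 i.2
  have h2 : (collapse m n ∘ fun k : Fin (n - m) => ⟨m + k, by omega⟩) = some := by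
    funext k
    exact collapse_eq_some.2 rfl
  have h3 : (collapse m n ∘ fun a : Option (Fin (n - m)) =>
      a.elim ⟨0, by omega⟩ fun k => ⟨m + k, by omega⟩) = id := by
    funext a
    cases a with
    | none => exact collapse_eq_none.2 h0
    | some k => exact congrFun h2 k
  rw [collapseLift, map_mul, rename_blockDiscr, rename_rename, h1, h2, h3, rename_id_apply,
    collapseDiscr]

/-- If `2 ≤ m`, a permutation followed by `collapse m n` either identifies two indices one of
which is at least `m`, or permutes the values of `collapse m n`. -/
theorem collapse_comp_perm_cases {m n : ℕ} (h2 : 2 ≤ m) (e : Equiv.Perm (Fin n)) :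
    (∃ i j : Fin n, i ≠ j ∧ m ≤ j ∧ collapse m n (e i) = collapse m n (e j)) ∨
      ∃ e' : Equiv.Perm (Fin (n - m)), collapse m n ∘ e = Option.map e' ∘ collapse m n := by
  refine or_iff_not_imp_left.2 fun H => ?_
  push Not at H
  have hsome (k : Fin (n - m)) : ∃ l, collapse m n (e ⟨m + k, by omega⟩) = some l := by
    rw [← Option.ne_none_iff_exists']
    intro h
    have hk := k.2
    obtain ⟨c, hc, hce⟩ : ∃ c : Fin n, (c : ℕ) < m ∧ c ≠ e ⟨m + k, by omega⟩ := by
      by_cases h0 : e ⟨m + k, by omega⟩ = ⟨0, by omega⟩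
      · exact ⟨⟨1, by omega⟩, by change 1 < m; omega, by simp [h0]⟩
      · exact ⟨⟨0, by omega⟩, by change 0 < m; omega, Ne.symm h0⟩
    refine H (e.symm c) ⟨m + k, by omega⟩ (fun h' => hce ?_) (by simp) ?_
    · rw [← h', Equiv.apply_symm_apply]
    · rw [Equiv.apply_symm_apply, h, collapse_eq_none.2 hc]
  choose φ hφ using hsome
  have hinj : Function.Injective φ := by
    intro k l hkl
    by_contra hne
    refine H ⟨m + k, by omega⟩ ⟨m + l, by omega⟩ ?_ (by simp) (by rw [hφ, hφ, hkl])
    simpa [Fin.ext_iff] using hne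
  refine ⟨Equiv.ofBijective φ (Finite.injective_iff_bijective.1 hinj), ?_⟩
  funext i
  by_cases hi : (i : ℕ) < m
  · simp only [Function.comp_apply, collapse_eq_none.2 hi, Option.map_none]
    by_contra hne
    obtain ⟨l, hl⟩ := Option.ne_none_iff_exists'.1 hne
    obtain ⟨k, rfl⟩ := Finite.surjective_of_injective hinj l
    refine H i ⟨m + k, by omega⟩ (by simp [Fin.ext_iff]; omega) (by simp) (by rw [hφ, hl])
  · obtain ⟨k, hk⟩ : ∃ k : Fin (n - m), (i : ℕ) = m + k :=
      ⟨⟨i - m, by omega⟩, by simp; omega⟩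
    have hi' : i = ⟨m + k, by omega⟩ := Fin.ext hk
    rw [Function.comp_apply, Function.comp_apply, collapse_eq_some.2 hk, hi', hφ]
    rfl

theorem exists_isSymmetric_rename_collapse [CharZero K] {m n d : ℕ} (h2 : 2 ≤ m) (hm : m < n)
    {q : MvPolynomial (Option (Fin (n - m))) K} (hq : q.IsHomogeneous d)
    (hs : ∀ e : Equiv.Perm (Fin (n - m)), rename (Option.map e) q = q) :
    ∃ f : MvPolynomial (Fin n) K, f.IsSymmetric ∧
      f.IsHomogeneous ((n - m) * m + (n - m) * (n - m - 1) + d) ∧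
      rename (collapse m n) f = collapseDiscr K m (n - m) * q ∧
      ∀ g : Fin n → Fin n, (∀ e : Equiv.Perm (Fin n),
        ∃ i j : Fin n, i ≠ j ∧ m ≤ j ∧ g (e i) = g (e j)) → rename g f = 0 := by
  classical
  set f := ∑ e : Equiv.Perm (Fin n), rename e (collapseLift hm q) with hf
  have hc (e : Equiv.Perm (Fin n)) : rename (collapse m n) (rename e (collapseLift hm q)) =
      (if ∃ e' : Equiv.Perm (Fin (n - m)), collapse m n ∘ e = Option.map e' ∘ collapse m n
        then 1 else 0 : K) • (collapseDiscr K m (n - m) * q) := by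
    rw [rename_rename]
    split_ifs with h
    · obtain ⟨e', he'⟩ := h
      rw [he', ← rename_rename, rename_collapse_collapseLift (by omega), map_mul,
        rename_collapseDiscr, hs, one_smul]
    · obtain ⟨i, j, hij, hj, h'⟩ := (collapse_comp_perm_cases h2 e).resolve_right h
      rw [rename_collapseLift_eq_zero hm q hij hj h', zero_smul]
  set N : K := ∑ e : Equiv.Perm (Fin n), if ∃ e' : Equiv.Perm (Fin (n - m)),
    collapse m n ∘ e = Option.map e' ∘ collapse m n then 1 else 0 with hN
  have hN0 : N ≠ 0 := by
    rw [hN, sum_boole, Nat.cast_ne_zero, card_ne_zero]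
    exact ⟨1, mem_filter.2 ⟨mem_univ _, 1, by simp⟩⟩
  refine ⟨N⁻¹ • f, fun e => ?_, ?_, ?_, fun g hg => ?_⟩
  · rw [map_smul, hf, map_sum]
    simp only [rename_rename]
    congr 1
    exact Equiv.sum_comp (Equiv.mulLeft e) fun e : Equiv.Perm (Fin n) =>
      rename e (collapseLift hm q)
  · exact (homogeneousSubmodule (Fin n) K _).smul_mem _ (IsHomogeneous.sum _ _ _ fun e _ =>
      ((isHomogeneous_blockDiscr _ _).mul hq.rename_isHomogeneous).rename_isHomogeneous)
  · rw [map_smul, hf, map_sum, sum_congr rfl fun e _ => hc e, ← sum_smul, smul_smul,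
      inv_mul_cancel₀ hN0, one_smul]
  · rw [map_smul, hf, map_sum, sum_eq_zero, smul_zero]
    intro e _
    obtain ⟨i, j, hij, hj, h'⟩ := hg e
    rw [rename_rename, rename_collapseLift_eq_zero hm q hij hj h']

end MvPolynomial

namespace MvPolynomial

section Symmetric

variable {R τ : Type*} [CommRing R]

theorem _root_.Equiv.Perm.exists_castLE_eq {k n : ℕ} (h : k ≤ n) {u : Fin k → Fin n}
    (hu : Function.Injective u) : ∃ e : Equiv.Perm (Fin n), ∀ i, e (Fin.castLE h i) = u i := by
  have := Equiv.Perm.isMultiplyPretransitive (Fin n) k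
  obtain ⟨e, he⟩ := MulAction.IsPretransitive.exists_smul_eq (M := Equiv.Perm (Fin n))
    (Fin.castLEEmb h) (⟨u, hu⟩ : Fin k ↪ Fin n)
  exact ⟨e, fun i => DFunLike.congr_fun he i⟩

theorem IsSymmetric.rename_eq_zero_of_comp {σ : Type*} {f : MvPolynomial σ R} (hf : f.IsSymmetric)
    {s : σ → σ} (hs : rename s f = 0) {g : σ → τ} (e : Equiv.Perm σ)
    (h : ∀ i, g (e (s i)) = g (e i)) : rename g f = 0 := by
  have h' : (g ∘ e) ∘ s = g ∘ e := _root_.funext h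
  rw [← hf.rename_comp g e, ← h', ← rename_rename, hs, map_zero]

end Symmetric

theorem sub24_apply {n : ℕ} (hn : 4 ≤ n) (f : MvPolynomial (Fin n) ℂ) :
    sub24 n hn f = rename (fun i : Fin n => if (i : ℕ) = 1 then ⟨0, by omega⟩
      else if (i : ℕ) = 3 then ⟨2, by omega⟩ else i) f := by
  refine DFunLike.congr_fun (algHom_ext fun i => ?_) f
  rw [sub24, aeval_X, rename_X]
  split_ifs <;> rfl

theorem sub123_apply {n : ℕ} (hn : 4 ≤ n) (f : MvPolynomial (Fin n) ℂ) :
    sub123 n hn f = rename (fun i : Fin n => if (i : ℕ) ≤ 2 then ⟨0, by omega⟩ else i) f := by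
  refine DFunLike.congr_fun (algHom_ext fun i => ?_) f
  rw [sub123, aeval_X, rename_X]
  split_ifs <;> rfl

theorem sub12_apply {n : ℕ} (hn : 4 ≤ n) (f : MvPolynomial (Fin n) ℂ) :
    sub12 n hn f = rename (fun i : Fin n => if (i : ℕ) = 1 then ⟨0, by omega⟩ else i) f := by
  refine DFunLike.congr_fun (algHom_ext fun i => ?_) f
  rw [sub12, aeval_X, rename_X]
  split_ifs <;> rfl

theorem rename_eq_zero_of_sub24 {τ : Type*} {n : ℕ} (hn : 4 ≤ n) {f : MvPolynomial (Fin n) ℂ}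
    (hf : f.IsSymmetric) (h : sub24 n hn f = 0) {g : Fin n → τ} {a b c d : Fin n}
    (hd : [a, b, c, d].Nodup) (hab : g a = g b) (hcd : g c = g d) : rename g f = 0 := by
  rw [sub24_apply] at h
  obtain ⟨e, he⟩ := Equiv.Perm.exists_castLE_eq hn (List.nodup_iff_injective_get.1 hd)
  refine hf.rename_eq_zero_of_comp h e fun i => ?_
  have h0 := he 0
  have h1 := he 1
  have h2 := he 2
  have h3 := he 3
  split_ifs with hi hi'
  · obtain rfl : i = Fin.castLE hn 1 := Fin.ext hi
    rw [h1]
    exact (congrArg g h0).trans hab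
  · obtain rfl : i = Fin.castLE hn 3 := Fin.ext hi'
    rw [h3]
    exact (congrArg g h2).trans hcd
  · rfl

theorem rename_eq_zero_of_sub123 {τ : Type*} {n : ℕ} (hn : 4 ≤ n) {f : MvPolynomial (Fin n) ℂ}
    (hf : f.IsSymmetric) (h : sub123 n hn f = 0) {g : Fin n → τ} {a b c : Fin n}
    (hd : [a, b, c].Nodup) (hab : g a = g b) (hac : g a = g c) : rename g f = 0 := by
  rw [sub123_apply] at h
  have hn' : 3 ≤ n := by omega
  obtain ⟨e, he⟩ := Equiv.Perm.exists_castLE_eq hn'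
    (List.nodup_iff_injective_get.1 hd)
  refine hf.rename_eq_zero_of_comp h e fun i => ?_
  have h0 := he 0
  have h1 := he 1
  have h2 := he 2
  split_ifs with hi
  · refine (congrArg g h0).trans ?_
    obtain hi | hi | hi : (i : ℕ) = 0 ∨ (i : ℕ) = 1 ∨ (i : ℕ) = 2 := by omega
    · obtain rfl : i = Fin.castLE hn' (0 : Fin 3) := Fin.ext hi
      rw [h0]
    · obtain rfl : i = Fin.castLE hn' (1 : Fin 3) := Fin.ext hi
      rw [h1]
      exact hab
    · obtain rfl : i = Fin.castLE hn' (2 : Fin 3) := Fin.ext hi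
      rw [h2]
      exact hac
  · rfl

theorem sub12_eq_zero_iff {n : ℕ} (hn : 4 ≤ n) (f : MvPolynomial (Fin n) ℂ) :
    sub12 n hn f = 0 ↔ rename (collapse 2 n) f = 0 := by
  rw [sub12_apply]
  constructor <;> intro h
  · have h' := congrArg (rename (collapse 2 n)) h
    rw [rename_rename, map_zero] at h'
    convert h' using 3
    funext i
    simp only [Function.comp_apply]
    split_ifs with hi
    · rw [collapse_eq_none.2 (by omega), collapse_eq_none.2 (by simp)]
    · rfl
  · have h' := congrArg (rename fun a : Option (Fin (n - 2)) =>
      a.elim (⟨0, by omega⟩ : Fin n) fun k => ⟨2 + k, by omega⟩) h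
    rw [rename_rename, map_zero] at h'
    convert h' using 3
    funext i
    simp only [Function.comp_apply, collapse]
    split_ifs <;> simp [Fin.ext_iff] <;> omega

theorem sub123_eq_zero_iff {n : ℕ} (hn : 4 ≤ n) (f : MvPolynomial (Fin n) ℂ) :
    sub123 n hn f = 0 ↔ rename (collapse 3 n) f = 0 := by
  rw [sub123_apply]
  constructor <;> intro h
  · have h' := congrArg (rename (collapse 3 n)) h
    rw [rename_rename, map_zero] at h'
    convert h' using 3
    funext i
    simp only [Function.comp_apply]
    split_ifs with hi
    · rw [collapse_eq_none.2 (by omega), collapse_eq_none.2 (by simp)]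
    · rfl
  · have h' := congrArg (rename fun a : Option (Fin (n - 3)) =>
      a.elim (⟨0, by omega⟩ : Fin n) fun k => ⟨3 + k, by omega⟩) h
    rw [rename_rename, map_zero] at h'
    convert h' using 3
    funext i
    simp only [Function.comp_apply, collapse]
    split_ifs <;> simp [Fin.ext_iff] <;> omega

end MvPolynomial

namespace MvPolynomial

theorem IsSymmetric.rename_swap_collapse {R : Type*} [CommRing R] {m n : ℕ}
    {f : MvPolynomial (Fin n) R} (hf : f.IsSymmetric) (e : Equiv.Perm (Fin (n - m))) :
    rename (Option.map e) (rename (collapse m n) f) = rename (collapse m n) f := by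
  obtain ⟨e', he'⟩ := exists_collapse_comp_perm (m := m) (n := n) e
  rw [rename_rename, ← he', hf.rename_comp]

theorem sq_X_some_sub_X_some_dvd {R : Type*} [CommRing R] [IsDomain R] [CharZero R] {m n : ℕ}
    {f : MvPolynomial (Fin n) R} (hf : f.IsSymmetric) {k l : Fin (n - m)} (hkl : k ≠ l)
    (h : X (some k) - X (some l) ∣ rename (collapse m n) f) :
    (X (some k) - X (some l)) ^ 2 ∣ rename (collapse m n) f := by
  have hkl' : some k ≠ some l := by simpa using hkl
  refine sq_X_sub_X_dvd_of_swap hkl' ?_ h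
  have h1 := hf.rename_swap_collapse (m := m) (Equiv.swap k l)
  rw [← Equiv.optionCongr_swap]
  exact h1

/-- The index `m + k`, which `collapse m n` maps to `some k`. -/
def collapseIdx {m n : ℕ} (k : Fin (n - m)) : Fin n := ⟨m + k, by omega⟩

theorem collapse_collapseIdx {m n : ℕ} (k : Fin (n - m)) :
    collapse m n (collapseIdx k) = some k := collapse_eq_some.2 rfl

theorem sq_X_some_sub_X_some_dvd_of_sub24 {m n : ℕ} (hn : 4 ≤ n) (h2 : 2 ≤ m)
    {f : MvPolynomial (Fin n) ℂ} (hf : f.IsSymmetric) (h : sub24 n hn f = 0)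
    {k l : Fin (n - m)} (hkl : k ≠ l) :
    (X (some k) - X (some l)) ^ 2 ∣ rename (collapse m n) f := by
  refine sq_X_some_sub_X_some_dvd hf hkl ((X_sub_X_dvd_iff _ _ _).2 ?_)
  have hk := k.2
  rw [rename_rename]
  refine rename_eq_zero_of_sub24 hn hf h (a := ⟨0, by omega⟩) (b := ⟨1, by omega⟩)
    (c := collapseIdx k) (d := collapseIdx l) ?_ ?_ ?_
  · simp [collapseIdx, Fin.ext_iff] at hkl ⊢
    omega
  · simp only [Function.comp_apply]
    rw [collapse_eq_none.2 (by change 0 < m; omega), collapse_eq_none.2 (by change 1 < m; omega)]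
  · simp [collapse_collapseIdx, hkl.symm]

theorem X_none_sub_X_some_sq_dvd {n : ℕ} (hn : 4 ≤ n) {f : MvPolynomial (Fin n) ℂ}
    (hf : f.IsSymmetric) (h : sub123 n hn f = 0) (k : Fin (n - 2)) :
    (X none - X (some k)) ^ 2 ∣ rename (collapse 2 n) f := by
  have h1 : X none - X (some k) ∣ rename (collapse 2 n) f := by
    rw [X_sub_X_dvd_iff, rename_rename]
    refine rename_eq_zero_of_sub123 hn hf h (a := ⟨0, by omega⟩) (b := ⟨1, by omega⟩)
      (c := collapseIdx k) ?_ ?_ ?_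
    · simp [collapseIdx, Fin.ext_iff]
      omega
    · simp [collapse_eq_none.2]
    · simp [collapse_eq_none.2, collapse_collapseIdx]
  obtain ⟨q, hq⟩ := h1
  have h2 := hf.card_mul_rename_pderiv (collapse 2 n) (Function.update id none (some k))
    (s := none) (t := some k) (by simp)
  rw [card_collapse_eq_none (by omega), card_collapse_eq_some, hq] at h2
  simp at h2
  rw [hq, sq]
  refine mul_dvd_mul_left _ ((X_sub_X_dvd_iff _ _ _).2 ?_)
  have h3 : (3 : MvPolynomial (Option (Fin (n - 2))) ℂ) *
    rename (Function.update id none (some k)) q = 0 := by linear_combination h2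
  exact (mul_eq_zero.1 h3).resolve_left (by norm_num)

theorem X_none_sub_X_some_cube_dvd {n : ℕ} (hn : 4 ≤ n) {f : MvPolynomial (Fin n) ℂ}
    (hf : f.IsSymmetric) (h : sub24 n hn f = 0) (k : Fin (n - 3)) :
    (X none - X (some k)) ^ 3 ∣ rename (collapse 3 n) f := by
  let y : Fin (n - 2) := ⟨0, by omega⟩
  let z : Fin (n - 2) := ⟨k + 1, by omega⟩
  have hyz : y ≠ z := by simp [y, z]
  let e : Option (Fin (n - 2)) → Option (Fin (n - 3)) := fun a =>
    a.elim none fun l => if h : (l : ℕ) = 0 then none else some ⟨l - 1, by omega⟩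
  have hex : e none = none := rfl
  have hey : e (some y) = none := rfl
  have hez : e (some z) = some k := by simp [e, z]
  have he : e ∘ collapse 2 n = collapse 3 n := by
    funext i
    simp only [e, collapse, Function.comp_apply]
    split_ifs <;> grind
  obtain ⟨q, hq⟩ := sq_X_some_sub_X_some_dvd_of_sub24 (m := 2) hn le_rfl hf h hyz
  have h2 := hf.card_mul_rename_pderiv (collapse 2 n) e (s := none) (t := some y) (by rw [hex, hey])
  rw [card_collapse_eq_none (by omega), card_collapse_eq_some, hq] at h2
  have hyz' : some z ≠ some y := by simpa using hyz.symm
  simp [hey, hez, hyz'] at h2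
  rw [map_ofNat] at h2
  rw [← he, ← rename_rename, hq]
  simp only [map_mul, map_pow, map_sub, rename_X, hey, hez]
  rw [pow_succ]
  refine mul_dvd_mul_left _ ?_
  set d : MvPolynomial (Option (Fin (n - 3))) ℂ := X none - X (some k) with hd
  have hd0 : d ≠ 0 := (prime_X_sub_X (by simp)).ne_zero
  have h4 : d ∣ 4 * rename e q := by
    refine ⟨rename e (pderiv none q) - 2 * rename e (pderiv (some y) q), ?_⟩
    apply mul_left_cancel₀ hd0
    linear_combination -h2
  rw [hd, X_sub_X_dvd_iff, map_mul, map_ofNat] at h4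
  exact (X_sub_X_dvd_iff _ _ _).2 ((mul_eq_zero.1 h4).resolve_left (by norm_num))

end MvPolynomial

namespace MvPolynomial

variable {K : Type*} [Field K]

/-- The algebra map sending `X none` to itself and `X (some i)` to the elementary symmetric
polynomial of degree `i + 1` in the variables `X (some k)`. -/
noncomputable def optionEsymm (K : Type*) [Field K] (r : ℕ) :
    MvPolynomial (Option (Fin r)) K →ₐ[K] MvPolynomial (Option (Fin r)) K :=
  aeval fun a => a.elim (X none) fun i => rename some (esymm (Fin r) K (i + 1))

/-- The degrees of the generators in `optionEsymm`. -/
def optionWeight (r : ℕ) (a : Option (Fin r)) : ℕ := a.elim 1 fun i => i + 1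

theorem optionEquivRight_optionEsymm (r : ℕ) (p : MvPolynomial (Option (Fin r)) K) :
    optionEquivRight K (Fin r) (optionEsymm K r p) =
      esymmAlgHom (Fin r) (Polynomial K) r (optionEquivRight K (Fin r) p) := by
  let f : MvPolynomial (Fin r) (Polynomial K) →ₐ[K] MvPolynomial (Fin r) (Polynomial K) :=
    ((symmetricSubalgebra (Fin r) (Polynomial K)).val.comp
      (esymmAlgHom (Fin r) (Polynomial K) r)).restrictScalars K
  have h : ((optionEquivRight K (Fin r)).toAlgHom.comp (optionEsymm K r)) =
      f.comp (optionEquivRight K (Fin r)).toAlgHom := by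
    refine algHom_ext fun a => ?_
    cases a with
    | none =>
      simp [optionEsymm, f]
    | some i =>
      simp [optionEsymm, f, esymm, esymmAlgHom]
  exact DFunLike.congr_fun h p

theorem optionEsymm_injective (r : ℕ) : Function.Injective (optionEsymm K r) := by
  intro p q h
  have h1 := congrArg (optionEquivRight K (Fin r)) h
  rw [optionEquivRight_optionEsymm, optionEquivRight_optionEsymm] at h1
  exact (optionEquivRight K (Fin r)).injective
    (esymmAlgHom_injective (Polynomial K) (by simp) (Subtype.ext h1))

theorem exists_optionEsymm_eq {r : ℕ} {p : MvPolynomial (Option (Fin r)) K}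
    (hp : ∀ e : Equiv.Perm (Fin r), rename (Option.map e) p = p) :
    ∃ q, optionEsymm K r q = p := by
  have hs : (optionEquivRight K (Fin r) p).IsSymmetric := by
    intro e
    have h : ((rename e).restrictScalars K : MvPolynomial (Fin r) (Polynomial K) →ₐ[K] _).comp
        (optionEquivRight K (Fin r)).toAlgHom =
        (optionEquivRight K (Fin r)).toAlgHom.comp (rename (Option.map e)) := by
      refine algHom_ext fun a => ?_
      cases a <;> simp
    have := DFunLike.congr_fun h p
    simpa [hp e] using this
  obtain ⟨q, hq⟩ := esymmAlgHom_surjective (σ := Fin r) (Polynomial K) (n := r) (by simp) ⟨_, hs⟩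
  refine ⟨(optionEquivRight K (Fin r)).symm q, (optionEquivRight K (Fin r)).injective ?_⟩
  rw [optionEquivRight_optionEsymm, AlgEquiv.apply_symm_apply, hq]

theorem rename_map_optionEsymm {r : ℕ} (p : MvPolynomial (Option (Fin r)) K)
    (e : Equiv.Perm (Fin r)) :
    rename (Option.map e) (optionEsymm K r p) = optionEsymm K r p := by
  have h : (rename (Option.map e)).comp (optionEsymm K r) = optionEsymm K r := by
    refine algHom_ext fun a => ?_
    cases a with
    | none => simp [optionEsymm]
    | some i =>
      have h1 : (Option.map e ∘ some : Fin r → Option (Fin r)) = some ∘ e := rfl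
      simp only [optionEsymm, AlgHom.comp_apply, aeval_X, Option.elim_some, rename_rename, h1]
      rw [← rename_rename, rename_esymm]
  exact DFunLike.congr_fun h p

theorem isHomogeneous_esymm (σ R : Type*) [Fintype σ] [CommRing R] (k : ℕ) :
    (esymm σ R k).IsHomogeneous k := by
  refine IsHomogeneous.sum _ _ _ fun t ht => ?_
  have h := IsHomogeneous.prod t (fun i => (X i : MvPolynomial σ R)) (fun _ => 1)
    fun i _ => isHomogeneous_X R i
  simpa [(mem_powersetCard.1 ht).2] using h

theorem IsWeightedHomogeneous.optionEsymm {r d : ℕ} {p : MvPolynomial (Option (Fin r)) K}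
    (hp : p.IsWeightedHomogeneous (optionWeight r) d) :
    (optionEsymm K r p).IsHomogeneous d := by
  rw [MvPolynomial.optionEsymm, aeval_def, eval₂_eq']
  refine IsHomogeneous.sum _ _ _ fun c hc => ?_
  have hd := hp (mem_support_iff.1 hc)
  rw [Finsupp.weight_apply, Finsupp.sum_fintype _ _ (by simp)] at hd
  rw [← hd, algebraMap_eq]
  refine IsHomogeneous.C_mul (IsHomogeneous.prod _ _ _ fun a _ => ?_) _
  rw [smul_eq_mul, mul_comm]
  refine IsHomogeneous.pow ?_ _
  cases a with
  | none => exact isHomogeneous_X K none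
  | some i => exact (isHomogeneous_esymm (Fin r) K (i + 1)).rename_isHomogeneous

end MvPolynomial

namespace MvPolynomial

theorem finrank_weightedHomogeneousSubmodule (K : Type*) [Field K] {σ : Type*} (w : σ → ℕ)
    (k : ℕ) :
    Module.finrank K (weightedHomogeneousSubmodule K w k) =
      Nat.card {c : σ →₀ ℕ // Finsupp.weight w c = k} := by
  rw [Module.finrank_eq_nat_card_basis
    ((basisRestrictSupport K {c : σ →₀ ℕ | Finsupp.weight w c = k}).map
      (LinearEquiv.ofEq _ _ (weightedHomogeneousSubmodule_eq_finsupp_supported K w k).symm))]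
  rfl

end MvPolynomial

theorem PowerSeries.mk_dvd_mul_one_sub_X_pow {w : ℕ} (hw : w ≠ 0) :
    (PowerSeries.mk fun k => if w ∣ k then (1 : ℚ) else 0) * (1 - PowerSeries.X ^ w) = 1 := by
  ext k
  rw [mul_sub, mul_one, map_sub, PowerSeries.coeff_mk, PowerSeries.coeff_mul_X_pow',
    PowerSeries.coeff_one]
  rcases lt_or_ge k w with h | h
  · rcases eq_or_ne k 0 with rfl | h0
    · simp [h.not_ge]
    · simp [h.not_ge, h0, Nat.not_dvd_of_pos_of_lt (Nat.pos_of_ne_zero h0) h]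
  · have h0 : k ≠ 0 := by omega
    simp [h, h0, (Nat.dvd_sub_iff_left h dvd_rfl : w ∣ k - w ↔ w ∣ k)]

theorem PowerSeries.mk_card_weight {σ : Type*} [Fintype σ] {w : σ → ℕ} (hw : ∀ t, w t ≠ 0) :
    (PowerSeries.mk fun k => (Nat.card {c : σ →₀ ℕ // Finsupp.weight w c = k} : ℚ)) *
      ∏ t, (1 - PowerSeries.X ^ w t) = 1 := by
  classical
  have h : (PowerSeries.mk fun k => (Nat.card {c : σ →₀ ℕ // Finsupp.weight w c = k} : ℚ)) =
      ∏ t, PowerSeries.mk fun k => if w t ∣ k then (1 : ℚ) else 0 := by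
    ext k
    simp only [PowerSeries.coeff_prod, PowerSeries.coeff_mk, Finset.prod_ite_zero,
      Finset.prod_const_one, Finset.sum_boole]
    congr 1
    rw [← Nat.card_eq_finsetCard]
    refine Nat.card_congr
      { toFun := fun c => ⟨Finsupp.equivFunOnFinite.symm fun t => c.1 t * w t, ?_⟩
        invFun := fun c => ⟨Finsupp.equivFunOnFinite.symm fun t => c.1 t / w t, ?_⟩
        left_inv := fun c => ?_
        right_inv := fun c => ?_ }
    · have hc := c.2
      rw [Finsupp.weight_apply, Finsupp.sum_fintype _ _ (by simp)] at hc
      simpa using hc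
    · have hc := c.2
      simp only [Finset.mem_filter, Finset.mem_finsuppAntidiag] at hc
      rw [Finsupp.weight_apply, Finsupp.sum_fintype _ _ (by simp)]
      refine Eq.trans ?_ hc.1.1
      exact Finset.sum_congr rfl fun t ht => Nat.div_mul_cancel (hc.2 t ht)
    · ext t
      simp [hw t]
    · ext t
      exact Nat.div_mul_cancel ((Finset.mem_filter.1 c.2).2 t (Finset.mem_univ t))
  rw [h, ← Finset.prod_mul_distrib]
  exact Finset.prod_eq_one fun t _ => PowerSeries.mk_dvd_mul_one_sub_X_pow (hw t)

theorem mk_card_optionWeight (r : ℕ) :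
    (PowerSeries.mk fun k =>
      (Nat.card {c : Option (Fin r) →₀ ℕ // Finsupp.weight (optionWeight r) c = k} : ℚ)) =
      (qPoch 1 * qPoch r)⁻¹ := by
  have h := PowerSeries.mk_card_weight (w := optionWeight r)
    (by rintro (_ | i) <;> simp [optionWeight])
  have h1 : ∏ t, (1 - (PowerSeries.X : PowerSeries ℚ) ^ optionWeight r t) =
      qPoch 1 * qPoch r := by
    rw [Fintype.prod_option]
    congr 1
    · simp [qPoch, optionWeight]
    · exact Fin.prod_univ_eq_prod_range
        (fun j => 1 - (PowerSeries.X : PowerSeries ℚ) ^ (j + 1)) r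
  rw [h1] at h
  refine (PowerSeries.eq_inv_iff_mul_eq_one fun h0 => ?_).2 h
  have := congrArg PowerSeries.constantCoeff h
  simp [h0] at this

theorem Submodule.finrank_map_add_finrank_inf_ker {K V W : Type*} [Field K] [AddCommGroup V]
    [Module K V] [AddCommGroup W] [Module K W] (φ : V →ₗ[K] W) (A : Submodule K V)
    [FiniteDimensional K A] :
    Module.finrank K (A.map φ) + Module.finrank K (A ⊓ LinearMap.ker φ : Submodule K V) =
      Module.finrank K A := by
  have h : (A ⊓ LinearMap.ker φ).submoduleOf A = (LinearMap.ker φ).comap A.subtype := by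
    ext x
    simp [Submodule.submoduleOf]
  rw [← LinearMap.finrank_range_add_finrank_ker (φ.domRestrict A), LinearMap.range_domRestrict,
    LinearMap.ker_domRestrict, ← h, (Submodule.submoduleOfEquivOfLe inf_le_left).finrank_eq]

namespace MvPolynomial

variable {K : Type*} [Field K]

theorem homogeneousComponent_map_of_isWeightedHomogeneous {σ τ : Type*} {w : σ → ℕ} {D : ℕ}
    (Φ : MvPolynomial σ K →ₗ[K] MvPolynomial τ K)
    (hΦ : ∀ k q, q.IsWeightedHomogeneous w k → (Φ q).IsHomogeneous (D + k)) (d : ℕ)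
    (q : MvPolynomial σ K) :
    homogeneousComponent d (Φ q) =
      if D ≤ d then Φ (weightedHomogeneousComponent w (d - D) q) else 0 := by
  induction q using MvPolynomial.induction_on' with
  | monomial c a =>
    have h := isWeightedHomogeneous_monomial w c a rfl
    rw [homogeneousComponent_of_mem (hΦ _ _ h), weightedHomogeneousComponent_of_mem h]
    split_ifs with h1 h2 h3 h4
    · rfl
    · omega
    · omega
    · omega
    · simp
    · rfl
  | add p q hp hq =>
    rw [map_add, map_add, hp, hq]
    split_ifs <;> simp

/-- A submodule of homogeneous polynomials over a field is finite-dimensional. -/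
theorem finiteDimensional_of_le_homogeneousSubmodule {σ : Type*} [Finite σ] {d : ℕ}
    {A : Submodule K (MvPolynomial σ K)} (hA : A ≤ homogeneousSubmodule σ K d) :
    FiniteDimensional K A :=
  have : FiniteDimensional K (homogeneousSubmodule σ K d) :=
    Module.Finite.iff_fg.2 (homogeneousSubmodule_fg σ K d)
  Submodule.finiteDimensional_of_le hA

theorem isHomogeneous_collapseDiscr (m r : ℕ) :
    (collapseDiscr K m r).IsHomogeneous (r * m + r * (r - 1)) :=
  isHomogeneous_blockDiscr _ _

/-- The images of a graded family of spaces of symmetric polynomials under the identification of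
the first `m` variables, when they consist of all admissible multiples of `collapseDiscr`. -/
theorem mk_finrank_sub_finrank [CharZero K] {m n : ℕ} (h2 : 2 ≤ m) (hm : m < n)
    (A B : ℕ → Submodule K (MvPolynomial (Fin n) K))
    (hsymm : ∀ d, ∀ f ∈ A d, f.IsSymmetric) (hhom : ∀ d, ∀ f ∈ A d, f.IsHomogeneous d)
    (hB : ∀ d, B d = A d ⊓ LinearMap.ker (rename (collapse m n)).toLinearMap)
    (hdvd : ∀ d, ∀ f ∈ A d, collapseDiscr K m (n - m) ∣ rename (collapse m n) f)
    (hmem : ∀ d (f : MvPolynomial (Fin n) K), f.IsSymmetric → f.IsHomogeneous d →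
      (∀ g : Fin n → Fin n, (∀ e : Equiv.Perm (Fin n), ∃ i j : Fin n,
        i ≠ j ∧ m ≤ j ∧ g (e i) = g (e j)) → rename g f = 0) → f ∈ A d) :
    PowerSeries.mk (fun d => (Module.finrank K (A d) : ℚ) - (Module.finrank K (B d) : ℚ)) =
      PowerSeries.X ^ ((n - m) * m + (n - m) * (n - m - 1)) *
        (qPoch 1 * qPoch (n - m))⁻¹ := by
  set D := (n - m) * m + (n - m) * (n - m - 1) with hD
  let Φ : MvPolynomial (Option (Fin (n - m))) K →ₗ[K] MvPolynomial (Option (Fin (n - m))) K :=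
    LinearMap.mulLeft K (collapseDiscr K m (n - m)) ∘ₗ (optionEsymm K (n - m)).toLinearMap
  have hΦ_apply : ∀ q, Φ q = collapseDiscr K m (n - m) * optionEsymm K (n - m) q := fun q => rfl
  have hΦ : ∀ k q, q.IsWeightedHomogeneous (optionWeight (n - m)) k →
      (Φ q).IsHomogeneous (D + k) := fun k q hq =>
    (isHomogeneous_collapseDiscr m (n - m)).mul hq.optionEsymm
  have hinj : Function.Injective Φ := fun p q h =>
    optionEsymm_injective _ (mul_left_cancel₀ (collapseDiscr_ne_zero m (n - m)) h)
  have hmap : ∀ d, (A d).map (rename (collapse m n)).toLinearMap =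
      if D ≤ d then (weightedHomogeneousSubmodule K (optionWeight (n - m)) (d - D)).map Φ
      else ⊥ := by
    intro d
    apply le_antisymm
    · rintro _ ⟨f, hf, rfl⟩
      obtain ⟨Q, hQ⟩ := hdvd d f hf
      have hQs : ∀ e : Equiv.Perm (Fin (n - m)), rename (Option.map e) Q = Q := fun e => by
        apply mul_left_cancel₀ (collapseDiscr_ne_zero (K := K) m (n - m))
        rw [← hQ, ← (hsymm d f hf).rename_swap_collapse e, hQ, map_mul, rename_collapseDiscr]
      obtain ⟨q, rfl⟩ := exists_optionEsymm_eq hQs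
      have h1 := homogeneousComponent_map_of_isWeightedHomogeneous Φ hΦ d q
      rw [hΦ_apply, ← hQ, homogeneousComponent_eq_self (hhom d f hf).rename_isHomogeneous] at h1
      simp only [AlgHom.toLinearMap_apply, h1]
      split_ifs
      · exact ⟨_, weightedHomogeneousComponent_mem _ _ _, rfl⟩
      · rfl
    · split_ifs with hd
      · rintro _ ⟨q, hq, rfl⟩
        obtain ⟨f, hfs, hfh, hf, hg⟩ := exists_isSymmetric_rename_collapse h2 hm
          (IsWeightedHomogeneous.optionEsymm hq) (rename_map_optionEsymm q)
        rw [← hD, Nat.add_sub_cancel' hd] at hfh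
        exact ⟨f, hmem d f hfs hfh hg, hf⟩
      · exact bot_le
  ext d
  have : FiniteDimensional K (A d) :=
    finiteDimensional_of_le_homogeneousSubmodule (d := d) fun f hf => hhom d f hf
  rw [PowerSeries.coeff_mk, hB, ← Submodule.finrank_map_add_finrank_inf_ker
    (rename (collapse m n)).toLinearMap (A d), hmap, ← mk_card_optionWeight,
    PowerSeries.coeff_X_pow_mul', Nat.cast_add, add_sub_cancel_right]
  split_ifs with hd
  · rw [if_pos hd, ← (Submodule.equivMapOfInjective Φ hinj _).finrank_eq,
      finrank_weightedHomogeneousSubmodule, PowerSeries.coeff_mk]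
  · rw [if_neg hd, finrank_bot, Nat.cast_zero]

end MvPolynomial

namespace MvPolynomial

theorem sub24_eq_zero_of_sub12 {n : ℕ} (hn : 4 ≤ n) {f : MvPolynomial (Fin n) ℂ}
    (h : sub12 n hn f = 0) : sub24 n hn f = 0 := by
  rw [sub12_apply] at h
  have h1 := congrArg
    (rename fun i : Fin n => if (i : ℕ) = 3 then (⟨2, by omega⟩ : Fin n) else i) h
  rw [rename_rename, map_zero] at h1
  rw [sub24_apply, ← h1]
  congr 2
  funext i
  simp only [Function.comp_apply, Fin.ext_iff]
  split_ifs <;> simp_all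

theorem sub123_eq_zero_of_sub12 {n : ℕ} (hn : 4 ≤ n) {f : MvPolynomial (Fin n) ℂ}
    (h : sub12 n hn f = 0) : sub123 n hn f = 0 := by
  rw [sub12_apply] at h
  have h1 := congrArg
    (rename fun i : Fin n => if (i : ℕ) = 2 then (⟨0, by omega⟩ : Fin n) else i) h
  rw [rename_rename, map_zero] at h1
  rw [sub123_apply, ← h1]
  congr 2
  funext i
  simp only [Function.comp_apply, Fin.ext_iff]
  split_ifs <;> simp_all
  omega

theorem F1Component_eq (n : ℕ) (hn : 4 ≤ n) (d : ℕ) :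
    F1Component n hn d =
      FComponent n hn d ⊓ LinearMap.ker (rename (collapse 2 n)).toLinearMap := by
  ext f
  simp only [F1Component, FComponent, F2Component, Submodule.mem_inf, LinearMap.mem_ker,
    AlgHom.toLinearMap_apply, ← sub12_eq_zero_iff hn]
  exact ⟨fun h => ⟨⟨⟨⟨h.1.1, sub24_eq_zero_of_sub12 hn h.1.2⟩, h.2⟩,
    sub123_eq_zero_of_sub12 hn h.1.2⟩, h.1.2⟩, fun h => ⟨⟨h.1.1.1.1, h.2⟩, h.1.1.2⟩⟩

theorem FComponent_eq (n : ℕ) (hn : 4 ≤ n) (d : ℕ) :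
    FComponent n hn d =
      F2Component n hn d ⊓ LinearMap.ker (rename (collapse 3 n)).toLinearMap := by
  ext f
  simp only [FComponent, Submodule.mem_inf, LinearMap.mem_ker, AlgHom.toLinearMap_apply,
    sub123_eq_zero_iff hn]

/-- One of two disjoint pairs of indices contains an element outside any set of three. -/
theorem exists_le_and_sub24_eq {m n : ℕ} (hn : 4 ≤ n) (hm : m ≤ 3) (e : Equiv.Perm (Fin n)) :
    ∃ i j : Fin n, i ≠ j ∧ m ≤ j ∧
      (fun i : Fin n => if (i : ℕ) = 1 then (⟨0, by omega⟩ : Fin n)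
        else if (i : ℕ) = 3 then ⟨2, by omega⟩ else i) (e i) =
      (fun i : Fin n => if (i : ℕ) = 1 then (⟨0, by omega⟩ : Fin n)
        else if (i : ℕ) = 3 then ⟨2, by omega⟩ else i) (e j) := by
  let x (k : ℕ) (hk : k < 4) : Fin n := e.symm ⟨k, by omega⟩
  have hx : ∀ k l hk hl, k ≠ l → (x k hk : ℕ) ≠ x l hl := fun k l hk hl hkl h => by
    have := congrArg Fin.val (e.symm.injective (Fin.ext h))
    exact hkl this
  have hx' : ∀ k l hk hl, k ≠ l → x k hk ≠ x l hl := fun k l hk hl hkl h =>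
    hx k l hk hl hkl (congrArg Fin.val h)
  have h01 := hx 0 1 (by omega) (by omega) (by omega)
  have h02 := hx 0 2 (by omega) (by omega) (by omega)
  have h03 := hx 0 3 (by omega) (by omega) (by omega)
  have h12 := hx 1 2 (by omega) (by omega) (by omega)
  have h13 := hx 1 3 (by omega) (by omega) (by omega)
  have h23 := hx 2 3 (by omega) (by omega) (by omega)
  have h : m ≤ x 0 (by omega) ∨ m ≤ x 1 (by omega) ∨ m ≤ x 2 (by omega) ∨
      m ≤ x 3 (by omega) := by omega
  rcases h with h | h | h | h
  · exact ⟨_, _, hx' 1 0 (by omega) (by omega) (by omega), h, by simp [x]⟩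
  · exact ⟨_, _, hx' 0 1 (by omega) (by omega) (by omega), h, by simp [x]⟩
  · exact ⟨_, _, hx' 3 2 (by omega) (by omega) (by omega), h, by simp [x]⟩
  · exact ⟨_, _, hx' 2 3 (by omega) (by omega) (by omega), h, by simp [x]⟩

theorem exists_le_and_sub123_eq {n : ℕ} (hn : 4 ≤ n) (e : Equiv.Perm (Fin n)) :
    ∃ i j : Fin n, i ≠ j ∧ 2 ≤ (j : ℕ) ∧
      (fun i : Fin n => if (i : ℕ) ≤ 2 then (⟨0, by omega⟩ : Fin n) else i) (e i) =
      (fun i : Fin n => if (i : ℕ) ≤ 2 then (⟨0, by omega⟩ : Fin n) else i) (e j) := by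
  let x (k : ℕ) (hk : k < 3) : Fin n := e.symm ⟨k, by omega⟩
  have hx : ∀ k l hk hl, k ≠ l → (x k hk : ℕ) ≠ x l hl := fun k l hk hl hkl h => by
    have := congrArg Fin.val (e.symm.injective (Fin.ext h))
    exact hkl this
  have hx' : ∀ k l hk hl, k ≠ l → x k hk ≠ x l hl := fun k l hk hl hkl h =>
    hx k l hk hl hkl (congrArg Fin.val h)
  have h01 := hx 0 1 (by omega) (by omega) (by omega)
  have h02 := hx 0 2 (by omega) (by omega) (by omega)
  have h12 := hx 1 2 (by omega) (by omega) (by omega)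
  have h : 2 ≤ (x 0 (by omega) : ℕ) ∨ 2 ≤ (x 1 (by omega) : ℕ) ∨ 2 ≤ (x 2 (by omega) : ℕ) := by
    omega
  rcases h with h | h | h
  · exact ⟨_, _, hx' 1 0 (by omega) (by omega) (by omega), h, by simp [x]⟩
  · exact ⟨_, _, hx' 0 1 (by omega) (by omega) (by omega), h, by simp [x]⟩
  · exact ⟨_, _, hx' 0 2 (by omega) (by omega) (by omega), h, by simp [x]⟩

end MvPolynomial

theorem quotient_characters (n : ℕ) (hn : 4 ≤ n) :
    (PowerSeries.mk (fun d =>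
        (Module.finrank ℂ (F2Component n hn d) : ℚ)
          - (Module.finrank ℂ (FComponent n hn d) : ℚ)) =
      PowerSeries.X ^ ((n - 1) * (n - 3)) * (qPoch 1 * qPoch (n - 3))⁻¹) ∧
    (PowerSeries.mk (fun d =>
        (Module.finrank ℂ (FComponent n hn d) : ℚ)
          - (Module.finrank ℂ (F1Component n hn d) : ℚ)) =
      PowerSeries.X ^ ((n - 2) * (n - 1)) * (qPoch 1 * qPoch (n - 2))⁻¹) := by
  constructor
  · have h := mk_finrank_sub_finrank (K := ℂ) (m := 3) (n := n) (by omega) (by omega)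
      (F2Component n hn) (FComponent n hn) (fun d f hf => hf.1.1) (fun d f hf => hf.2)
      (FComponent_eq n hn)
      (fun d f hf => collapseDiscr_dvd (X_none_sub_X_some_cube_dvd hn hf.1.1 hf.1.2)
        fun k l hkl => sq_X_some_sub_X_some_dvd_of_sub24 hn (by omega) hf.1.1 hf.1.2 hkl)
      (fun d f hs hd hg => ⟨⟨hs, (sub24_apply hn f).trans
        (hg _ fun e => exists_le_and_sub24_eq hn le_rfl e)⟩, hd⟩)
    rw [h]
    obtain ⟨n, rfl⟩ := Nat.exists_eq_add_of_le' hn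
    congr 2
    simp only [Nat.reduceSubDiff, Nat.add_sub_cancel]
    ring
  · have h := mk_finrank_sub_finrank (K := ℂ) (m := 2) (n := n) le_rfl (by omega)
      (FComponent n hn) (F1Component n hn) (fun d f hf => hf.1.1.1) (fun d f hf => hf.1.2)
      (F1Component_eq n hn)
      (fun d f hf => collapseDiscr_dvd (X_none_sub_X_some_sq_dvd hn hf.1.1.1 hf.2)
        fun k l hkl => sq_X_some_sub_X_some_dvd_of_sub24 hn le_rfl hf.1.1.1 hf.1.1.2 hkl)
      (fun d f hs hd hg => ⟨⟨⟨hs, (sub24_apply hn f).trans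
        (hg _ fun e => exists_le_and_sub24_eq hn (by omega) e)⟩, hd⟩,
        (sub123_apply hn f).trans (hg _ fun e => exists_le_and_sub123_eq hn e)⟩)
    rw [h]
    obtain ⟨n, rfl⟩ := Nat.exists_eq_add_of_le' hn
    congr 2
    simp only [Nat.reduceSubDiff]
    ring
end

section
/- Let f ∈ ℂ[q,t] be a polynomial and let (k_1,l_1),...,(k_p,l_p) be pairs of nonnegative integers, not both zero, with 2k_j ≠ l_j for each j. For real θ and real q > 0 with q ≠ 1, set u_θ(q) = f(q, q^θ) / ∏_{j=1}^{p} (1 − q^{k_j + θ l_j}). Write the convergent expansion f(1+r, (1+r)^θ) = Σ_{m=0}^∞ a_m(θ) r^m for |r| < 1, where each a_m(θ) is a polynomial in θ. Assume a_0(θ), a_1(θ), ..., a_{p−1}(θ) are all identically zero. Then for every real θ_0 such that k_j + θ_0 l_j ≠ 0 for all j (in particular for θ_0 = −1/2), the limit as q → 1 of u_{θ_0}(q) exists and equals (−1)^p a_p(θ_0) / ∏_{j=1}^{p} (k_j + θ_0 l_j). -/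
open Finset Filter

/-- A power series in a real variable that vanishes to order `p` at `0`, divided by `r ^ p`,
tends to its `p`-th coefficient. -/
theorem tendsto_div_pow_of_hasSum (p : ℕ) (c : ℕ → ℂ) (g : ℝ → ℂ)
    (hg : ∀ r : ℝ, |r| < 1 → HasSum (fun m : ℕ => c m * (r : ℂ) ^ m) (g r))
    (hc : ∀ m < p, c m = 0) :
    Tendsto (fun r : ℝ => g r / (r : ℂ) ^ p) (nhdsWithin 0 {0}ᶜ) (nhds (c p)) := by
  have hsum : ∀ r : ℝ, r ≠ 0 → |r| < 1 →
      HasSum (fun m : ℕ => c (m + p) * (r : ℂ) ^ m) (g r / (r : ℂ) ^ p) := by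
    intro r hr hr1
    have hrc : (r : ℂ) ^ p ≠ 0 := pow_ne_zero _ (by exact_mod_cast hr)
    have h := (hasSum_nat_add_iff' p).mpr (hg r hr1)
    rw [Finset.sum_eq_zero fun m hm => by rw [hc m (Finset.mem_range.mp hm), zero_mul],
      sub_zero] at h
    refine (h.div_const ((r : ℂ) ^ p)).congr_fun fun m => ?_
    rw [pow_add]
    field_simp
  have hbound : Summable fun m : ℕ => ‖c (m + p)‖ * (1 / 2 : ℝ) ^ m := by
    have h := (hsum (1 / 2) (by norm_num) (by norm_num [abs_lt])).summable.norm
    refine h.congr fun m => ?_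
    rw [norm_mul, norm_pow, Complex.norm_real]
    norm_num
  have hcont : ContinuousOn (fun r : ℝ => ∑' m : ℕ, c (m + p) * (r : ℂ) ^ m)
      (Set.Icc (-(1 / 2)) (1 / 2)) := by
    refine continuousOn_tsum (fun m => by fun_prop) hbound fun m r hr => ?_
    rw [norm_mul, norm_pow, Complex.norm_real, Real.norm_eq_abs]
    gcongr
    exact abs_le.mpr hr
  have hnhds : Set.Icc (-(1 / 2) : ℝ) (1 / 2) ∈ nhds (0 : ℝ) :=
    Icc_mem_nhds (by norm_num) (by norm_num)
  have hlim := (hcont.continuousAt hnhds).tendsto.mono_left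
    (nhdsWithin_le_nhds (s := ({0}ᶜ : Set ℝ)))
  have hzero : ∑' m : ℕ, c (m + p) * ((0 : ℝ) : ℂ) ^ m = c p := by
    rw [tsum_eq_single 0 fun m hm => by simp [hm]]
    simp
  rw [hzero] at hlim
  refine hlim.congr' ?_
  filter_upwards [self_mem_nhdsWithin, mem_nhdsWithin_of_mem_nhds hnhds] with r hr hr2
  exact (hsum r hr ((abs_le.mpr hr2).trans_lt (by norm_num))).tsum_eq

/-- The difference quotient of `q ↦ 1 - q ^ s` at `1` tends to `-s`. -/
theorem tendsto_one_sub_rpow_div (s : ℝ) :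
    Tendsto (fun q : ℝ => (1 - ((q ^ s : ℝ) : ℂ)) / ((q - 1 : ℝ) : ℂ))
      (nhdsWithin 1 {1}ᶜ) (nhds (-(s : ℂ))) := by
  have h := (Real.hasDerivAt_rpow_const (x := 1) (p := s) (Or.inl one_ne_zero)).tendsto_slope.neg
  have h2 := (Complex.continuous_ofReal.tendsto _).comp h
  simp only [Real.one_rpow, mul_one, Complex.ofReal_neg] at h2
  refine h2.congr fun q => ?_
  simp only [Function.comp_apply, slope_def_field, Real.one_rpow]
  push_cast
  ring

/-- Lemma on limits of rational expressions `f(q, q^θ) / ∏ (1 - q^{k_j + θ l_j})` as `q → 1`: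
if the expansion `f(1+r, (1+r)^θ) = ∑ a_m(θ) r^m` (with `a_m` polynomials in `θ`) has
`a_0 = ⋯ = a_{p-1} = 0`, then for any real `θ₀` with `k_j + θ₀ l_j ≠ 0` for all `j`, the limit
as `q → 1` (through positive `q ≠ 1`) exists and equals
`(-1)^p a_p(θ₀) / ∏ (k_j + θ₀ l_j)`. -/
theorem limit_lemma (p : ℕ) (f : MvPolynomial (Fin 2) ℂ)
    (k l : Fin p → ℕ)
    (hkl : ∀ j, ¬ (k j = 0 ∧ l j = 0))
    (hkl2 : ∀ j, 2 * k j ≠ l j)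
    (a : ℕ → Polynomial ℂ)
    (ha : ∀ (θ : ℝ) (r : ℝ), |r| < 1 →
      HasSum (fun m : ℕ => (a m).eval (θ : ℂ) * (r : ℂ) ^ m)
        (MvPolynomial.eval
          (![(((1 + r : ℝ) : ℂ)), ((((1 + r : ℝ) ^ θ : ℝ) : ℂ))]) f))
    (hvanish : ∀ m, m < p → a m = 0)
    (θ0 : ℝ) (hθ0 : ∀ j, (k j : ℝ) + θ0 * (l j : ℝ) ≠ 0) :
    Filter.Tendsto
      (fun q : ℝ =>
        MvPolynomial.eval (![((q : ℂ)), (((q ^ θ0 : ℝ) : ℂ))]) f /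
          ∏ j, (1 - ((q ^ ((k j : ℝ) + θ0 * (l j : ℝ)) : ℝ) : ℂ)))
      (nhdsWithin 1 {q : ℝ | 0 < q ∧ q ≠ 1})
      (nhds ((-1) ^ p * (a p).eval (θ0 : ℂ) /
        ∏ j, ((k j : ℂ) + (θ0 : ℂ) * (l j : ℂ)))) := by
  have hset : {q : ℝ | 0 < q ∧ q ≠ 1} ⊆ {1}ᶜ := fun q hq => hq.2
  have hshift : Tendsto (fun q : ℝ => q - 1) (nhdsWithin 1 {q : ℝ | 0 < q ∧ q ≠ 1})
      (nhdsWithin 0 {0}ᶜ) := by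
    refine tendsto_nhdsWithin_iff.mpr ⟨?_, ?_⟩
    · have h : Tendsto (fun q : ℝ => q - 1) (nhds 1) (nhds (1 - 1)) :=
        (continuous_id.sub continuous_const).tendsto 1
      rw [sub_self] at h
      exact h.mono_left nhdsWithin_le_nhds
    · filter_upwards [self_mem_nhdsWithin] with q hq
      exact sub_ne_zero.mpr hq.2
  have hnum := (tendsto_div_pow_of_hasSum p (fun m => (a m).eval (θ0 : ℂ)) _ (ha θ0)
    fun m hm => by simp [hvanish m hm]).comp hshift
  have hden := tendsto_finsetProd (Finset.univ : Finset (Fin p)) fun j _ =>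
    (tendsto_one_sub_rpow_div ((k j : ℝ) + θ0 * (l j : ℝ))).mono_left (nhdsWithin_mono 1 hset)
  have hne : ∏ j, (-(((k j : ℝ) + θ0 * (l j : ℝ) : ℝ) : ℂ)) ≠ 0 :=
    Finset.prod_ne_zero_iff.mpr fun j _ => neg_ne_zero.mpr (by exact_mod_cast hθ0 j)
  have hlim := hnum.div hden hne
  have hval : (a p).eval (θ0 : ℂ) / ∏ j, (-(((k j : ℝ) + θ0 * (l j : ℝ) : ℝ) : ℂ)) =
      (-1) ^ p * (a p).eval (θ0 : ℂ) / ∏ j, ((k j : ℂ) + (θ0 : ℂ) * (l j : ℂ)) := by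
    have hsign : ((-1 : ℂ) ^ p) * (-1) ^ p = 1 := by rw [← mul_pow]; simp
    rw [Finset.prod_neg, Finset.card_univ, Fintype.card_fin]
    push_cast
    rw [← mul_div_mul_left _ _ (left_ne_zero_of_mul_eq_one hsign), ← mul_assoc, hsign, one_mul]
  rw [hval] at hlim
  refine hlim.congr' ?_
  filter_upwards [self_mem_nhdsWithin] with q hq
  have hq1 : (((q - 1 : ℝ) : ℂ)) ^ p ≠ 0 :=
    pow_ne_zero _ (Complex.ofReal_ne_zero.mpr (sub_ne_zero.mpr hq.2))
  simp only [Pi.div_apply, Function.comp_apply, Finset.prod_div_distrib, Finset.prod_const,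
    Finset.card_univ, Fintype.card_fin, add_sub_cancel]
  exact div_div_div_cancel_right₀ hq1 _ _
end
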